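/- arXiv:1404.0890 — 2 statements merged into one kernel-verified Lean document; each statement's English description precedes it below -/
import Mathlib

section
/- Let V be a Banach space, T>0, and let μ be a C¹-approximate flow on V with constants c₁>0 and a>1. Fix ε∈(0,1) and let L be any constant with L > 2c₁/(1−m_ε). Then there exists δ>0 such that for all 0≤s≤t≤T with t−s≤δ and every ε-special partition π_{ts} of [s,t], one has the C¹ estimate ‖μ_{π_{ts}} − μ_{ts}‖_{C¹} ≤ L|t−s|^a. -/
/-!
Statement 3: C¹ estimate on ε-special partitions (proposition 2.6 / PropSecondStep).
-/

variable {V : Type*} [NormedAddCommGroup V] [NormedSpace ℝ V] [CompleteSpace V]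

/-- The composition `μ_{t_n t_{n-1}} ∘ ⋯ ∘ μ_{t_1 t_0}` along the points `tt 0, …, tt n`. -/
def compAlong (μ : ℝ → ℝ → V → V) (tt : ℕ → ℝ) : ℕ → V → V
  | 0 => id
  | n + 1 => μ (tt (n + 1)) (tt n) ∘ compAlong μ tt n

/-- `tt 0 = s < tt 1 < ⋯ < tt n = t` is a partition of `[s, t]`. -/
def IsPartition (s t : ℝ) (n : ℕ) (tt : ℕ → ℝ) : Prop :=
  tt 0 = s ∧ tt n = t ∧ ∀ i < n, tt i < tt (i + 1)

/-- A `C¹`-approximate flow on `V` over the time interval `[0,T]`, with constants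
`c₁ > 0` and `a > 1`. -/
def IsC1ApproxFlow (T c₁ a : ℝ) (μ : ℝ → ℝ → V → V) : Prop :=
  (∀ s t, 0 ≤ s → s ≤ t → t ≤ T → ContDiff ℝ 2 (μ t s)) ∧
  (∀ s₀ t₀, 0 ≤ s₀ → s₀ ≤ t₀ → t₀ ≤ T → ∀ ε > (0:ℝ), ∃ η > (0:ℝ), ∀ s t,
    0 ≤ s → s ≤ t → t ≤ T → |s - s₀| ≤ η → |t - t₀| ≤ η →
    ∀ x, ‖μ t s x - μ t₀ s₀ x‖ ≤ ε) ∧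
  (∀ ε > (0:ℝ), ∃ η > (0:ℝ), ∀ s t, 0 ≤ s → s ≤ t → t ≤ T → t - s ≤ η → ∀ x,
    ‖μ t s x - x‖ + ‖fderiv ℝ (μ t s) x - ContinuousLinearMap.id ℝ V‖ +
      ‖iteratedFDeriv ℝ 2 (μ t s) x‖ ≤ ε) ∧
  (∀ s u t, 0 ≤ s → s ≤ u → u ≤ t → t ≤ T → ∀ x,
    ‖μ t u (μ u s x) - μ t s x‖ +
      ‖fderiv ℝ (fun y => μ t u (μ u s y)) x - fderiv ℝ (μ t s) x‖ ≤ c₁ * (t - s) ^ a)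

/-- The partition of `[tt i, tt j]` given by the points `tt i, tt (i+1), …, tt j` is
`ε`-special: it is either trivial, or there is a partition point `tt k` with
`ε ≤ (tt k - tt i)/(tt j - tt i) ≤ 1 - ε`, and for any such point the two induced
partitions of `[tt i, tt k]` and `[tt k, tt j]` are again `ε`-special. -/
inductive EpsSpecial (ε : ℝ) (tt : ℕ → ℝ) : ℕ → ℕ → Prop where
  | triv {i j : ℕ} : j ≤ i + 1 → EpsSpecial ε tt i j
  | node {i j : ℕ} :
      i + 1 < j →
      (∃ k, i < k ∧ k < j ∧ ε ≤ (tt k - tt i) / (tt j - tt i) ∧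
        (tt k - tt i) / (tt j - tt i) ≤ 1 - ε) →
      (∀ k, i < k → k < j → ε ≤ (tt k - tt i) / (tt j - tt i) →
        (tt k - tt i) / (tt j - tt i) ≤ 1 - ε → EpsSpecial ε tt i k) →
      (∀ k, i < k → k < j → ε ≤ (tt k - tt i) / (tt j - tt i) →
        (tt k - tt i) / (tt j - tt i) ≤ 1 - ε → EpsSpecial ε tt k j) →
      EpsSpecial ε tt i j

/-- `m_ε = sup_{ε ≤ β ≤ 1-ε} (β^a + (1-β)^a)`. -/
noncomputable def mEps (ε a : ℝ) : ℝ :=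
  sSup ((fun β : ℝ => β ^ a + (1 - β) ^ a) '' Set.Icc ε (1 - ε))

/-- A sequence composed along `m + n` steps splits at step `m`. -/
theorem compAlong_add {E : Type*} (μ : ℝ → ℝ → E → E) (tt : ℕ → ℝ) (m n : ℕ) :
    compAlong μ tt (m + n) = compAlong μ (fun l => tt (m + l)) n ∘ compAlong μ tt m := by
  induction n with
  | zero => rfl
  | succ n ih =>
    change μ (tt (m + n + 1)) (tt (m + n)) ∘ compAlong μ tt (m + n) = _
    rw [ih]
    rfl

theorem differentiable_compAlong {E : Type*} [NormedAddCommGroup E] [NormedSpace ℝ E]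
    (μ : ℝ → ℝ → E → E) (tt : ℕ → ℝ) (n : ℕ)
    (h : ∀ i < n, Differentiable ℝ (μ (tt (i + 1)) (tt i))) :
    Differentiable ℝ (compAlong μ tt n) := by
  induction n with
  | zero => exact differentiable_id
  | succ n ih => exact (h n n.lt_succ_self).comp (ih fun i hi => h i (hi.trans n.lt_succ_self))

theorem norm_le_one_add_of_norm_sub_id_le {E : Type*} [NormedAddCommGroup E] [NormedSpace ℝ E]
    {A : E →L[ℝ] E} {e : ℝ} (h : ‖A - ContinuousLinearMap.id ℝ E‖ ≤ e) : ‖A‖ ≤ 1 + e := by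
  have h₁ := norm_le_norm_add_norm_sub' A (ContinuousLinearMap.id ℝ E)
  have h₂ : ‖ContinuousLinearMap.id ℝ E‖ ≤ 1 := ContinuousLinearMap.norm_id_le
  linarith

/-- Stability of composition in the `C¹` distance. -/
theorem C1_dist_comp_le {E : Type*} [NormedAddCommGroup E] [NormedSpace ℝ E]
    {f F g G : E → E} (hf : Differentiable ℝ f) (hF : ContDiff ℝ 2 F)
    (hg : Differentiable ℝ g) (hG : Differentiable ℝ G) {x : E} {e κ A B : ℝ} (he : 0 ≤ e)
    (heκ : 2 * e + e * e ≤ κ) (hfF : ∀ y, ‖f y - F y‖ + ‖fderiv ℝ f y - fderiv ℝ F y‖ ≤ A)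
    (hgG : ‖g x - G x‖ + ‖fderiv ℝ g x - fderiv ℝ G x‖ ≤ B)
    (hF₁ : ∀ y, ‖fderiv ℝ F y‖ ≤ 1 + e) (hF₂ : ∀ y, ‖iteratedFDeriv ℝ 2 F y‖ ≤ e)
    (hG₁ : ‖fderiv ℝ G x‖ ≤ 1 + e) (hg₁ : ‖fderiv ℝ g x‖ ≤ 1 + κ) :
    ‖f (g x) - F (G x)‖ + ‖fderiv ℝ (f ∘ g) x - fderiv ℝ (F ∘ G) x‖ ≤ (1 + κ) * (A + B) := by
  have hF' : Differentiable ℝ F := hF.differentiable (by norm_num)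
  have hDF : Differentiable ℝ (fderiv ℝ F) :=
    (hF.fderiv_right (m := 1) (by norm_num)).differentiable (by norm_num)
  have hlip : ‖F (g x) - F (G x)‖ ≤ (1 + e) * ‖g x - G x‖ :=
    convex_univ.norm_image_sub_le_of_norm_fderiv_le (fun y _ => hF' y) (fun y _ => hF₁ y)
      (Set.mem_univ _) (Set.mem_univ _)
  have hlip' : ‖fderiv ℝ F (g x) - fderiv ℝ F (G x)‖ ≤ e * ‖g x - G x‖ := by
    refine convex_univ.norm_image_sub_le_of_norm_fderiv_le (𝕜 := ℝ) (fun y _ => hDF y)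
      (fun y _ => ?_) (Set.mem_univ _) (Set.mem_univ _)
    rw [← norm_iteratedFDeriv_one, norm_iteratedFDeriv_fderiv]
    exact hF₂ y
  rw [fderiv_comp x (hf _) (hg _), fderiv_comp x (hF' _) (hG _)]
  have hval : ‖f (g x) - F (G x)‖ ≤ ‖f (g x) - F (g x)‖ + ‖F (g x) - F (G x)‖ :=
    norm_sub_le_norm_sub_add_norm_sub _ _ _
  have hsplit : (fderiv ℝ f (g x)).comp (fderiv ℝ g x) - (fderiv ℝ F (G x)).comp (fderiv ℝ G x)
      = (fderiv ℝ f (g x) - fderiv ℝ F (g x)).comp (fderiv ℝ g x)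
        + (fderiv ℝ F (g x)).comp (fderiv ℝ g x - fderiv ℝ G x)
        + (fderiv ℝ F (g x) - fderiv ℝ F (G x)).comp (fderiv ℝ G x) := by
    ext v
    simp
  have h₁ : ‖(fderiv ℝ f (g x) - fderiv ℝ F (g x)).comp (fderiv ℝ g x)‖
      ≤ ‖fderiv ℝ f (g x) - fderiv ℝ F (g x)‖ * (1 + κ) :=
    (ContinuousLinearMap.opNorm_comp_le _ _).trans (by gcongr)
  have h₂ : ‖(fderiv ℝ F (g x)).comp (fderiv ℝ g x - fderiv ℝ G x)‖
      ≤ (1 + e) * ‖fderiv ℝ g x - fderiv ℝ G x‖ :=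
    (ContinuousLinearMap.opNorm_comp_le _ _).trans (by gcongr; exact hF₁ _)
  have h₃ : ‖(fderiv ℝ F (g x) - fderiv ℝ F (G x)).comp (fderiv ℝ G x)‖
      ≤ e * ‖g x - G x‖ * (1 + e) :=
    (ContinuousLinearMap.opNorm_comp_le _ _).trans (by gcongr)
  have hder := norm_add₃_le (a := (fderiv ℝ f (g x) - fderiv ℝ F (g x)).comp (fderiv ℝ g x))
    (b := (fderiv ℝ F (g x)).comp (fderiv ℝ g x - fderiv ℝ G x))
    (c := (fderiv ℝ F (g x) - fderiv ℝ F (G x)).comp (fderiv ℝ G x))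
  rw [← hsplit] at hder
  have hκ : 0 ≤ κ := le_trans (by positivity) heκ
  have hA := mul_le_mul_of_nonneg_left (hfF (g x)) (by linarith : 0 ≤ 1 + κ)
  have hB := mul_le_mul_of_nonneg_left hgG (by linarith : 0 ≤ 1 + κ)
  have h₄ := mul_nonneg hκ (norm_nonneg (f (g x) - F (g x)))
  have h₅ := mul_le_mul_of_nonneg_right heκ (norm_nonneg (g x - G x))
  have h₆ := mul_le_mul_of_nonneg_right (by nlinarith : e ≤ κ)
    (norm_nonneg (fderiv ℝ g x - fderiv ℝ G x))
  linarith

theorem continuous_rpow_add_one_sub_rpow {a : ℝ} (ha : 1 < a) :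
    Continuous fun β : ℝ => β ^ a + (1 - β) ^ a := by
  have h : Continuous fun β : ℝ => β ^ a := Real.continuous_rpow_const (by linarith)
  exact h.add (h.comp (continuous_const.sub continuous_id))

theorem rpow_add_one_sub_rpow_le_mEps {ε a β : ℝ} (ha : 1 < a) (hβ : β ∈ Set.Icc ε (1 - ε)) :
    β ^ a + (1 - β) ^ a ≤ mEps ε a :=
  le_csSup (isCompact_Icc.image (continuous_rpow_add_one_sub_rpow ha)).bddAbove
    (Set.mem_image_of_mem _ hβ)

theorem mEps_lt_one {ε a : ℝ} (hε : 0 < ε) (ha : 1 < a) : mEps ε a < 1 := by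
  rcases (Set.Icc ε (1 - ε)).eq_empty_or_nonempty with h | h
  · simp [mEps, h]
  · obtain ⟨β, hβ, hmax⟩ := (isCompact_Icc.image (continuous_rpow_add_one_sub_rpow ha)).sSup_mem
      (h.image _)
    rw [mEps, ← hmax]
    have hβ₀ : 0 < β := hε.trans_le hβ.1
    have hβ₁ : β < 1 := by linarith [hβ.2]
    have h₁ := Real.rpow_lt_rpow_of_exponent_gt hβ₀ hβ₁ ha
    have h₂ := Real.rpow_lt_rpow_of_exponent_gt (by linarith : 0 < 1 - β) (by linarith) ha
    rw [Real.rpow_one] at h₁ h₂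
    simp only
    linarith

/-- The superadditivity gain at an admissible division point. -/
theorem rpow_add_rpow_le_mEps_mul {ε a r s t : ℝ} (hε : 0 < ε) (ha : 1 < a) (hst : r < t)
    (h₁ : ε ≤ (s - r) / (t - r)) (h₂ : (s - r) / (t - r) ≤ 1 - ε) :
    (t - s) ^ a + (s - r) ^ a ≤ mEps ε a * (t - r) ^ a := by
  have hd : 0 < t - r := sub_pos.2 hst
  set β := (s - r) / (t - r) with hβ
  have hs : s - r = β * (t - r) := by rw [hβ]; field_simp
  have ht : t - s = (1 - β) * (t - r) := by linarith
  rw [ht, hs, Real.mul_rpow (by linarith) hd.le, Real.mul_rpow (by linarith) hd.le, ← add_mul,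
    add_comm]
  exact mul_le_mul_of_nonneg_right (rpow_add_one_sub_rpow_le_mEps ha ⟨h₁, h₂⟩) (by positivity)

/-- `C¹` estimate on a special partition, once the mesh parameters are small enough. -/
theorem EpsSpecial.C1_estimate {E : Type*} [NormedAddCommGroup E] [NormedSpace ℝ E]
    {T c₁ a ε L e κ δ : ℝ} {μ : ℝ → ℝ → E → E} (ha : 1 < a) (hε : 0 < ε) (hL₀ : 0 ≤ L)
    (hsmooth : ∀ s t, 0 ≤ s → s ≤ t → t ≤ T → ContDiff ℝ 2 (μ t s))
    (hdiag : ∀ s, 0 ≤ s → s ≤ T → μ s s = id)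
    (hnear : ∀ s t, 0 ≤ s → s ≤ t → t ≤ T → t - s ≤ δ → ∀ x,
      ‖fderiv ℝ (μ t s) x - ContinuousLinearMap.id ℝ E‖ ≤ e ∧ ‖iteratedFDeriv ℝ 2 (μ t s) x‖ ≤ e)
    (happrox : ∀ s u t, 0 ≤ s → s ≤ u → u ≤ t → t ≤ T → ∀ x,
      ‖μ t u (μ u s x) - μ t s x‖ +
        ‖fderiv ℝ (fun y => μ t u (μ u s y)) x - fderiv ℝ (μ t s) x‖ ≤ c₁ * (t - s) ^ a)
    (he : 0 ≤ e) (heκ : 2 * e + e * e ≤ κ) (hδκ : e + L * δ ^ a ≤ κ)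
    (hL : (1 + κ) * L * mEps ε a + c₁ ≤ L)
    {n : ℕ} {tt : ℕ → ℝ} (h0 : 0 ≤ tt 0) (hT : tt n ≤ T) (hδ : tt n - tt 0 ≤ δ)
    (hmono : ∀ i < n, tt i < tt (i + 1)) {i j : ℕ} (hij : i ≤ j) (hjn : j ≤ n)
    (hsp : EpsSpecial ε tt i j) (x : E) :
    ‖compAlong μ (fun l => tt (i + l)) (j - i) x - μ (tt j) (tt i) x‖ +
      ‖fderiv ℝ (compAlong μ (fun l => tt (i + l)) (j - i)) x - fderiv ℝ (μ (tt j) (tt i)) x‖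
        ≤ L * (tt j - tt i) ^ a := by
  have hlt : ∀ p q, p < q → q ≤ n → tt p < tt q := by
    intro p q hpq
    induction q, hpq using Nat.le_induction with
    | base => exact fun h => hmono p h
    | succ q _ ih => exact fun h => (ih (by omega)).trans (hmono q h)
  have hle : ∀ p q, p ≤ q → q ≤ n → tt p ≤ tt q := fun p q hpq hq =>
    hpq.eq_or_lt.elim (fun h => h ▸ le_rfl) fun h => (hlt p q h hq).le
  have hpos : ∀ p ≤ n, 0 ≤ tt p := fun p hp => h0.trans (hle 0 p p.zero_le hp)
  have hend : ∀ p ≤ n, tt p ≤ T := fun p hp => (hle p n hp le_rfl).trans hT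
  have hlen : ∀ p q, p ≤ q → q ≤ n → tt q - tt p ≤ δ := fun p q hpq hq => by
    linarith [hle q n hq le_rfl, hle 0 p p.zero_le (hpq.trans hq)]
  have hC2 : ∀ p q, p ≤ q → q ≤ n → ContDiff ℝ 2 (μ (tt q) (tt p)) := fun p q hpq hq =>
    hsmooth _ _ (hpos p (hpq.trans hq)) (hle p q hpq hq) (hend q hq)
  have hdiff : ∀ p q, p ≤ q → q ≤ n →
      Differentiable ℝ (compAlong μ (fun l => tt (p + l)) (q - p)) := fun p q hpq hq =>
    differentiable_compAlong _ _ _ fun l hl =>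
      (hC2 (p + l) (p + (l + 1)) (by omega) (by omega)).differentiable (by norm_num)
  have hnear' : ∀ p q, p ≤ q → q ≤ n → ∀ y,
      ‖fderiv ℝ (μ (tt q) (tt p)) y - ContinuousLinearMap.id ℝ E‖ ≤ e ∧
        ‖iteratedFDeriv ℝ 2 (μ (tt q) (tt p)) y‖ ≤ e := fun p q hpq hq =>
    hnear _ _ (hpos p (hpq.trans hq)) (hle p q hpq hq) (hend q hq) (hlen p q hpq hq)
  induction hsp generalizing x with
  | @triv i j hji =>
    have hd : 0 ≤ tt j - tt i := sub_nonneg.2 (hle i j hij hjn)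
    rcases hij.eq_or_lt with rfl | hlt'
    · rw [hdiag _ (hpos i hjn) (hend i hjn), Nat.sub_self]
      simp only [compAlong, sub_self, norm_zero, add_zero]
      positivity
    · obtain rfl : j = i + 1 := by omega
      rw [Nat.add_sub_cancel_left]
      simp only [compAlong, Function.comp_id, zero_add, add_zero, sub_self, norm_zero]
      positivity
  | @node i j hij' hex _ _ ih₁ ih₂ =>
    obtain ⟨k, hik, hkj, hk₁, hk₂⟩ := hex
    have hkn : k ≤ n := hkj.le.trans hjn
    have hleft := ih₁ k hik hkj hk₁ hk₂ hik.le hkn x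
    have hright := ih₂ k hik hkj hk₁ hk₂ hkj.le hjn
    have hcomp : compAlong μ (fun l => tt (i + l)) (j - i)
        = compAlong μ (fun l => tt (k + l)) (j - k) ∘
          compAlong μ (fun l => tt (i + l)) (k - i) := by
      have h := compAlong_add μ (fun l => tt (i + l)) (k - i) (j - k)
      have hshift : (fun l => tt (i + (k - i + l))) = fun l => tt (k + l) := by
        funext l
        congr 1
        omega
      rwa [hshift, show k - i + (j - k) = j - i by omega] at h
    set f := compAlong μ (fun l => tt (k + l)) (j - k)
    set g := compAlong μ (fun l => tt (i + l)) (k - i)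
    have hG := (hnear' i k hik.le hkn x).1
    have hgap : L * (tt k - tt i) ^ a ≤ L * δ ^ a := by
      have := Real.rpow_le_rpow (sub_nonneg.2 (hle i k hik.le hkn)) (hlen i k hik.le hkn)
        (by linarith : 0 ≤ a)
      gcongr
    have hg₁ : ‖fderiv ℝ g x‖ ≤ 1 + κ := by
      apply norm_le_one_add_of_norm_sub_id_le
      have := norm_sub_le_norm_sub_add_norm_sub (fderiv ℝ g x) (fderiv ℝ (μ (tt k) (tt i)) x)
        (ContinuousLinearMap.id ℝ E)
      linarith [norm_nonneg (g x - μ (tt k) (tt i) x)]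
    have hstep := C1_dist_comp_le (hdiff k j hkj.le hjn) (hC2 k j hkj.le hjn)
      (hdiff i k hik.le hkn) ((hC2 i k hik.le hkn).differentiable (by norm_num)) he heκ hright
      hleft (fun y => norm_le_one_add_of_norm_sub_id_le (hnear' k j hkj.le hjn y).1)
      (fun y => (hnear' k j hkj.le hjn y).2) (norm_le_one_add_of_norm_sub_id_le hG) hg₁
    have hlast := happrox (tt i) (tt k) (tt j) (hpos i (hij.trans hjn)) (hle i k hik.le hkn)
      (hle k j hkj.le hjn) (hend j hjn) x
    have hval := norm_sub_le_norm_sub_add_norm_sub (f (g x))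
      (μ (tt j) (tt k) (μ (tt k) (tt i) x)) (μ (tt j) (tt i) x)
    have hder := norm_sub_le_norm_sub_add_norm_sub (fderiv ℝ (f ∘ g) x)
      (fderiv ℝ (μ (tt j) (tt k) ∘ μ (tt k) (tt i)) x) (fderiv ℝ (μ (tt j) (tt i)) x)
    have hgain := rpow_add_rpow_le_mEps_mul hε ha (hlt i j (by omega) hjn) hk₁ hk₂
    have hκ : 0 ≤ κ := le_trans (by positivity) heκ
    have hgain' := mul_le_mul_of_nonneg_left hgain (by positivity : 0 ≤ (1 + κ) * L)
    have hfinal := mul_le_mul_of_nonneg_right hL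
      (Real.rpow_nonneg (sub_nonneg.2 (hle i j hij hjn)) a)
    rw [hcomp]
    change ‖f (g x) - _‖ + _ ≤ _
    change _ + ‖fderiv ℝ (μ (tt j) (tt k) ∘ μ (tt k) (tt i)) x - _‖ ≤ _ at hlast
    linarith

/-- C¹ estimate `‖μ_{π_{ts}} - μ_{ts}‖_{C¹} ≤ L |t-s|^a` along `ε`-special partitions. -/
theorem special_partition_C1_estimate
    (T c₁ a : ℝ) (hT : 0 < T) (hc₁ : 0 < c₁) (ha : 1 < a)
    (μ : ℝ → ℝ → V → V) (hμ : IsC1ApproxFlow T c₁ a μ)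
    (ε : ℝ) (hε : 0 < ε) (hε1 : ε < 1)
    (L : ℝ) (hL : 2 * c₁ / (1 - mEps ε a) < L) :
    ∃ δ > (0:ℝ), ∀ s t, 0 ≤ s → s ≤ t → t ≤ T → t - s ≤ δ →
      ∀ n (tt : ℕ → ℝ), IsPartition s t n tt → EpsSpecial ε tt 0 n →
      ∀ x, ‖compAlong μ tt n x - μ t s x‖ +
        ‖fderiv ℝ (compAlong μ tt n) x - fderiv ℝ (μ t s) x‖ ≤ L * (t - s) ^ a := by
  obtain ⟨hsmooth, -, hsmall, happrox⟩ := hμ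
  have hm : 0 < 1 - mEps ε a := sub_pos.2 (mEps_lt_one hε ha)
  have hL₀ : 0 < L := lt_trans (by positivity) hL
  rw [div_lt_iff₀ hm] at hL
  set κ := 1 - mEps ε a - c₁ / L with hκ_def
  have hκL : κ * L = L * (1 - mEps ε a) - c₁ := by rw [hκ_def]; field_simp
  have hκ : 0 < κ := pos_of_mul_pos_left (by rw [hκL]; linarith) hL₀.le
  set e := min 1 (κ / 3)
  have he : 0 < e := by positivity
  have he₁ : e ≤ 1 := min_le_left _ _
  have he₂ : e ≤ κ / 3 := min_le_right _ _
  obtain ⟨η, hη, hclose⟩ := hsmall e he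
  set δ := min η (min 1 (κ / (3 * L)))
  have hδ : 0 < δ := by positivity
  have hδ₁ : δ ≤ 1 := (min_le_right _ _).trans (min_le_left _ _)
  have hδ₂ : δ ≤ κ / (3 * L) := (min_le_right _ _).trans (min_le_right _ _)
  have hδa : δ ^ a ≤ δ := by
    simpa using Real.rpow_le_rpow_of_exponent_ge hδ hδ₁ ha.le
  have hLδ : L * δ ^ a ≤ κ / 3 := by
    calc L * δ ^ a ≤ L * (κ / (3 * L)) := by gcongr; exact hδa.trans hδ₂
      _ = κ / 3 := by field_simp
  have hdiag : ∀ s, 0 ≤ s → s ≤ T → μ s s = id := by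
    intro s hs hsT
    funext x
    refine sub_eq_zero.1 (norm_le_zero_iff.1 (le_of_forall_pos_le_add fun r hr => ?_))
    obtain ⟨η', hη', h⟩ := hsmall r hr
    have := h s s hs le_rfl hsT (by simpa using hη'.le) x
    simp only [id]
    linarith [norm_nonneg (fderiv ℝ (μ s s) x - ContinuousLinearMap.id ℝ V),
      norm_nonneg (iteratedFDeriv ℝ 2 (μ s s) x)]
  refine ⟨δ, hδ, ?_⟩
  rintro _ _ hs - ht hts n tt ⟨rfl, rfl, hmono⟩ hsp x
  have hnear : ∀ s t, 0 ≤ s → s ≤ t → t ≤ T → t - s ≤ δ → ∀ x,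
      ‖fderiv ℝ (μ t s) x - ContinuousLinearMap.id ℝ V‖ ≤ e ∧
        ‖iteratedFDeriv ℝ 2 (μ t s) x‖ ≤ e := by
    intro s t hs hst ht hts x
    have h := hclose s t hs hst ht (hts.trans (min_le_left _ _)) x
    have h₀ := norm_nonneg (μ t s x - x)
    have h₁ := norm_nonneg (fderiv ℝ (μ t s) x - ContinuousLinearMap.id ℝ V)
    have h₂ := norm_nonneg (iteratedFDeriv ℝ 2 (μ t s) x)
    exact ⟨by linarith, by linarith⟩
  have hκm : κ * L * mEps ε a ≤ κ * L := mul_le_of_le_one_right (by positivity) (by linarith)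
  simpa using hsp.C1_estimate ha hε hL₀.le hsmooth hdiag hnear happrox he.le (κ := κ)
    (by nlinarith) (by linarith) (by linarith) hs ht hts hmono n.zero_le le_rfl x
end

section
/- (Lyons' extension theorem, one step.) Fix ℓ≥1, n≥1, and constants c>0 and a>1. Let X = (X¹,…,Xⁿ) be continuous maps X^k : {(s,t) : 0≤s≤t≤1} → (ℝ^ℓ)^{⊗k} that are multiplicative, i.e. X^k_{ts} = Σ_{i+j=k, i,j≥0} X^i_{us} ⊗ X^j_{tu} (with X⁰ ≡ 1) for all 0≤s≤u≤t≤1 and 1≤k≤n. Let Y^{n+1} : {(s,t) : 0≤s≤t≤1} → (ℝ^ℓ)^{⊗(n+1)} be continuous and such that the collection (1, X¹, …, Xⁿ, Y^{n+1}) is almost-multiplicative: |Y^{n+1}_{ts} − Σ_{i+j=n+1, i,j≥0} Y^i_{us} ⊗ Y^j_{tu}| ≤ c|t−s|^{(n+1)a} for all 0≤s≤u≤t≤1 (where Y^i = X^i for i≤n). Then there exists a unique continuous map X^{n+1} : {(s,t) : 0≤s≤t≤1} → (ℝ^ℓ)^{⊗(n+1)} such that (1, X¹, …, Xⁿ, X^{n+1})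 is multiplicative and, for some constant c₁>0, |X^{n+1}_{ts} − Y^{n+1}_{ts}| ≤ c₁|t−s|^{(n+1)a} for all 0≤s≤t≤1. -/
/-!
Statement 7: one step of Lyons' extension theorem.

A `k`-tensor over `ℝ^ℓ` is represented by its coordinates in the canonical basis of
`(ℝ^ℓ)^{⊗k}`, i.e. by a function on words of length `k` over the alphabet `Fin ℓ`;
the tensor product is then concatenation of words, and the Euclidean norm of a `k`-tensor
is the square root of the sum of the squares of its coordinates.  A multi-level map is
encoded as a single function `X : ℝ → ℝ → List (Fin ℓ) → ℝ`, whose value on words of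
length `k` gives the level-`k` component `X^k`.
-/

/-- Euclidean norm of the level-`i` component of `g : List (Fin ℓ) → ℝ`. -/
noncomputable def tnorm (ℓ i : ℕ) (g : List (Fin ℓ) → ℝ) : ℝ :=
  Real.sqrt (∑ v : Fin i → Fin ℓ, g (List.ofFn v) ^ 2)

/-- The extension property: `Z` is a candidate level-`(n+1)` component extending the
multiplicative map `X = (1, X¹, …, Xⁿ)`: it is continuous, the extended collection
`(1, X¹, …, Xⁿ, Z)` is multiplicative, and `Z` is `(n+1)a`-close to `Y^{n+1}`. -/
def IsExtension (ℓ n : ℕ) (a : ℝ) (X Y Z : ℝ → ℝ → List (Fin ℓ) → ℝ) : Prop :=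
  (∀ w : List (Fin ℓ), w.length = n + 1 →
    ContinuousOn (fun q : ℝ × ℝ => Z q.2 q.1 w)
      {q : ℝ × ℝ | 0 ≤ q.1 ∧ q.1 ≤ q.2 ∧ q.2 ≤ 1}) ∧
  (∀ s u t : ℝ, 0 ≤ s → s ≤ u → u ≤ t → t ≤ 1 → ∀ w : List (Fin ℓ), w.length = n + 1 →
    Z t s w = Z u s w + Z t u w +
      ∑ i ∈ Finset.Ioo 0 w.length, X u s (w.take i) * X t u (w.drop i)) ∧
  (∃ c₁ > (0:ℝ), ∀ s t : ℝ, 0 ≤ s → s ≤ t → t ≤ 1 →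
    tnorm ℓ (n + 1) (fun w => Z t s w - Y t s w) ≤ c₁ * (t - s) ^ ((n + 1 : ℝ) * a))

/-- The Riemann-type sum of `W` over the `2 ^ m` equal subintervals of `[s, t]`. -/
noncomputable def dyadicSum (W : ℝ → ℝ → ℝ) : ℕ → ℝ → ℝ → ℝ
  | 0 => W
  | m + 1 => fun s t => dyadicSum W m s ((s + t) / 2) + dyadicSum W m ((s + t) / 2) t

theorem dyadicSum_sub (V W : ℝ → ℝ → ℝ) (m : ℕ) (s t : ℝ) :
    dyadicSum (V - W) m s t = dyadicSum V m s t - dyadicSum W m s t := by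
  induction m generalizing s t with
  | zero => rfl
  | succ m ih => simp only [dyadicSum, ih]; ring

theorem dyadicSum_dyadicSum_one (W : ℝ → ℝ → ℝ) (m : ℕ) (s t : ℝ) :
    dyadicSum (dyadicSum W 1) m s t = dyadicSum W (m + 1) s t := by
  induction m generalizing s t with
  | zero => rfl
  | succ m ih => simp only [dyadicSum] at ih ⊢; rw [ih, ih]

theorem abs_dyadicSum_le {W : ℝ → ℝ → ℝ} {g : ℝ → ℝ} {C γ : ℝ}
    (h : ∀ a b, 0 ≤ a → a ≤ b → b ≤ 1 → |W a b| ≤ C * (b - a) ^ γ * (g b - g a))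
    (m : ℕ) {a b : ℝ} (ha : 0 ≤ a) (hab : a ≤ b) (hb : b ≤ 1) :
    |dyadicSum W m a b| ≤ C * ((b - a) / 2 ^ m) ^ γ * (g b - g a) := by
  induction m generalizing a b with
  | zero => simpa [dyadicSum] using h a b ha hab hb
  | succ m ih =>
    have h1 := ih (a := a) (b := (a + b) / 2) ha (by linarith) (by linarith)
    have h2 := ih (a := (a + b) / 2) (b := b) (by linarith) (by linarith) hb
    have e1 : ((a + b) / 2 - a) / 2 ^ m = (b - a) / 2 ^ (m + 1) := by field_simp; ring
    have e2 : (b - (a + b) / 2) / 2 ^ m = (b - a) / 2 ^ (m + 1) := by field_simp; ring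
    rw [e1] at h1
    rw [e2] at h2
    calc _ ≤ _ := abs_add_le _ _
      _ ≤ _ := add_le_add h1 h2
      _ = _ := by ring

theorem div_two_pow_rpow {x : ℝ} (hx : 0 ≤ x) (m : ℕ) (γ : ℝ) :
    (x / 2 ^ m) ^ γ = x ^ γ * ((2 : ℝ) ^ (-γ)) ^ m := by
  rw [Real.div_rpow hx (by positivity), div_eq_mul_inv, Real.rpow_neg (by norm_num), inv_pow,
    ← Real.rpow_natCast, ← Real.rpow_natCast, ← Real.rpow_mul (by norm_num),
    ← Real.rpow_mul (by norm_num), mul_comm γ]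

theorem two_rpow_neg_lt_one {γ : ℝ} (hγ : 0 < γ) : (2 : ℝ) ^ (-γ) < 1 :=
  Real.rpow_lt_one_of_one_lt_of_neg (by norm_num) (by linarith)

theorem tendsto_div_two_pow_rpow {x : ℝ} (hx : 0 ≤ x) {γ : ℝ} (hγ : 0 < γ) (A B : ℝ) :
    Filter.Tendsto (fun m : ℕ => A * (x / 2 ^ m) ^ γ * B) Filter.atTop (nhds 0) := by
  simp_rw [div_two_pow_rpow hx]
  have := tendsto_pow_atTop_nhds_zero_of_lt_one (r := (2 : ℝ) ^ (-γ)) (by positivity)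
    (two_rpow_neg_lt_one hγ)
  simpa using ((this.const_mul (x ^ γ)).const_mul A).mul_const B

theorem rpow_eq_rpow_sub_one_mul {x θ : ℝ} (hx : 0 ≤ x) (hθ : 1 < θ) :
    x ^ θ = x ^ (θ - 1) * x := by
  rw [← Real.rpow_add_one' hx (by linarith), sub_add_cancel]

/-- An almost midpoint-additive two-parameter function that is bounded by some power larger
than one of the length obeys the bound given by its defect. -/
theorem abs_le_of_almost_midpoint_additive {E : ℝ → ℝ → ℝ} {c C θ η : ℝ}
    (hθ : 1 < θ) (hη : 1 < η)
    (hE : ∀ s t, 0 ≤ s → s ≤ t → t ≤ 1 →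
      |E s t - E s ((s + t) / 2) - E ((s + t) / 2) t| ≤ c * (t - s) ^ θ)
    (hC : ∀ s t, 0 ≤ s → s ≤ t → t ≤ 1 → |E s t| ≤ C * (t - s) ^ η)
    {s t : ℝ} (hs : 0 ≤ s) (hst : s ≤ t) (ht : t ≤ 1) :
    |E s t| ≤ c / (1 - 2 ^ (1 - θ)) * (t - s) ^ θ := by
  have hq : (2 : ℝ) ^ (1 - θ) < 1 := by
    simpa using two_rpow_neg_lt_one (γ := θ - 1) (by linarith)
  set K := c / (1 - 2 ^ (1 - θ)) with hK
  have hKc : K * 2 ^ (1 - θ) + c = K := by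
    have : K * (1 - 2 ^ (1 - θ)) = c := div_mul_cancel₀ _ (by linarith)
    linarith
  have hhalf : ∀ x : ℝ, 0 ≤ x → 2 * (x / 2) ^ θ = 2 ^ (1 - θ) * x ^ θ := by
    intro x hx
    rw [Real.div_rpow hx (by norm_num), Real.rpow_sub (by norm_num), Real.rpow_one]
    ring
  have key : ∀ m : ℕ, ∀ s t, 0 ≤ s → s ≤ t → t ≤ 1 →
      |E s t| ≤ K * (t - s) ^ θ + |C| * ((t - s) / 2 ^ m) ^ (η - 1) * (t - s) + |K| *
        (2 ^ (1 - θ)) ^ m * (t - s) ^ θ := by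
    intro m
    induction m with
    | zero =>
      intro s t hs hst ht
      have h0 : 0 ≤ t - s := by linarith
      have h1 := hC s t hs hst ht
      have h2 : C * (t - s) ^ η ≤ |C| * (t - s) ^ η := by gcongr; exact le_abs_self _
      have h3 : -|K| * (t - s) ^ θ ≤ K * (t - s) ^ θ := by gcongr; exact neg_abs_le _
      rw [rpow_eq_rpow_sub_one_mul h0 hη] at h2 h1
      simp only [pow_zero, div_one]
      linarith
    | succ m ih =>
      intro s t hs hst ht
      have h0 : 0 ≤ t - s := by linarith
      have h1 := ih s ((s + t) / 2) hs (by linarith) (by linarith)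
      have h2 := ih ((s + t) / 2) t (by linarith) (by linarith) ht
      have h3 := hE s t hs hst ht
      have e1 : (s + t) / 2 - s = (t - s) / 2 := by ring
      have e2 : t - (s + t) / 2 = (t - s) / 2 := by ring
      have e3 : (t - s) / 2 / 2 ^ m = (t - s) / 2 ^ (m + 1) := by field_simp; ring
      rw [e1, e3] at h1
      rw [e2, e3] at h2
      have hh := hhalf _ h0
      have h4 : |E s t| ≤ |E s t - E s ((s + t) / 2) - E ((s + t) / 2) t| +
          |E s ((s + t) / 2)| + |E ((s + t) / 2) t| := by
        calc |E s t| = |(E s t - E s ((s + t) / 2) - E ((s + t) / 2) t) +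
              E s ((s + t) / 2) + E ((s + t) / 2) t| := by congr 1; ring
          _ ≤ _ := abs_add_three _ _ _
      refine h4.trans ((add_le_add (add_le_add h3 h1) h2).trans (le_of_eq ?_))
      rw [pow_succ]
      linear_combination (K + |K| * (2 ^ (1 - θ)) ^ m) * hh + (t - s) ^ θ * hKc
  have h0 : 0 ≤ t - s := by linarith
  have hlim : Filter.Tendsto (fun m : ℕ => K * (t - s) ^ θ +
      |C| * ((t - s) / 2 ^ m) ^ (η - 1) * (t - s) + |K| * (2 ^ (1 - θ)) ^ m * (t - s) ^ θ)
      Filter.atTop (nhds (K * (t - s) ^ θ + 0 + |K| * 0 * (t - s) ^ θ)) :=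
    (tendsto_const_nhds.add (tendsto_div_two_pow_rpow h0 (by linarith) _ _)).add
      (((tendsto_pow_atTop_nhds_zero_of_lt_one (by positivity) hq).const_mul _).mul_const _)
  have := ge_of_tendsto' hlim fun m => key m s t hs hst ht
  simpa using this

/-- The two-parameter function `W` stopped outside the interval `[s, t]`. -/
def clipped (W : ℝ → ℝ → ℝ) (s t : ℝ) : ℝ → ℝ → ℝ :=
  fun a b => W (max s (min t a)) (max s (min t b))

theorem clip_sub_clip_le {s t a b : ℝ} (hab : a ≤ b) :
    max s (min t b) - max s (min t a) ≤ b - a := by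
  rcases max_cases s (min t b) with h | h <;> rcases max_cases s (min t a) with h' | h' <;>
    rcases min_cases t b with k | k <;> rcases min_cases t a with k' | k' <;> linarith

section Sewing

variable {W : ℝ → ℝ → ℝ} {c θ : ℝ}

theorem abs_clipped_midpoint_defect_le (hc : 0 ≤ c) (hθ : 1 < θ)
    (hW : ∀ s u t, 0 ≤ s → s ≤ u → u ≤ t → t ≤ 1 →
      |W s t - W s u - W u t| ≤ c * (t - s) ^ θ)
    {s t : ℝ} (hs : 0 ≤ s) (hst : s ≤ t) (ht : t ≤ 1) (a b : ℝ) (hab : a ≤ b) :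
    |(dyadicSum (clipped W s t) 1 - clipped W s t) a b| ≤
      c * (t - s) ^ ((θ - 1) / 2) * (b - a) ^ ((θ - 1) / 2) *
        (max s (min t b) - max s (min t a)) := by
  have hmono : ∀ {x y : ℝ}, x ≤ y → max s (min t x) ≤ max s (min t y) := fun h => by gcongr
  have hge : ∀ x : ℝ, s ≤ max s (min t x) := fun x => le_max_left _ _
  have hle : ∀ x : ℝ, max s (min t x) ≤ t := fun x => max_le hst (min_le_left _ _)
  have h := hW (max s (min t a)) (max s (min t ((a + b) / 2))) (max s (min t b))
    (hs.trans (hge _)) (hmono (by linarith)) (hmono (by linarith)) ((hle _).trans ht)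
  have hd := clip_sub_clip_le (s := s) (t := t) hab
  have hd0 : 0 ≤ max s (min t b) - max s (min t a) := sub_nonneg.2 (hmono hab)
  have hdr : max s (min t b) - max s (min t a) ≤ t - s := by linarith [hge a, hle b]
  rw [rpow_eq_rpow_sub_one_mul hd0 hθ] at h
  set d := max s (min t b) - max s (min t a)
  have hsplit : d ^ (θ - 1) ≤ (t - s) ^ ((θ - 1) / 2) * (b - a) ^ ((θ - 1) / 2) := by
    have : d ^ (θ - 1) = d ^ ((θ - 1) / 2) * d ^ ((θ - 1) / 2) := by
      rw [← Real.rpow_add_of_nonneg hd0 (by linarith) (by linarith), add_halves]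
    rw [this]
    have hγ : 0 ≤ (θ - 1) / 2 := by linarith
    have := sub_nonneg.2 hab
    gcongr
  have e : (dyadicSum (clipped W s t) 1 - clipped W s t) a b =
      -(W (max s (min t a)) (max s (min t b)) -
        W (max s (min t a)) (max s (min t ((a + b) / 2))) -
        W (max s (min t ((a + b) / 2))) (max s (min t b))) := by
    simp only [Pi.sub_apply, dyadicSum, clipped]; ring
  rw [e, abs_neg]
  calc _ ≤ _ := h
    _ = c * d ^ (θ - 1) * d := by ring
    _ ≤ c * ((t - s) ^ ((θ - 1) / 2) * (b - a) ^ ((θ - 1) / 2)) * d := by gcongr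
    _ = _ := by ring

theorem abs_clipped_additivity_defect_le (hc : 0 ≤ c) (hθ : 1 < θ)
    (hW : ∀ s u t, 0 ≤ s → s ≤ u → u ≤ t → t ≤ 1 →
      |W s t - W s u - W u t| ≤ c * (t - s) ^ θ)
    {s t v : ℝ} (hs : 0 ≤ s) (hst : s ≤ t) (htv : t ≤ v) (hv : v ≤ 1) (a b : ℝ) (hab : a ≤ b) :
    |(clipped W s v - clipped W s t - clipped W t v) a b| ≤ c * (b - a) ^ (θ - 1) * (b - a) := by
  have h0 : 0 ≤ b - a := sub_nonneg.2 hab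
  have hdiag : W t t = 0 := by
    have := hW t t t (hs.trans hst) le_rfl le_rfl (htv.trans hv)
    rw [sub_self (t : ℝ), Real.zero_rpow (by linarith), mul_zero] at this
    have := abs_nonpos_iff.1 this
    linarith
  have hpos : 0 ≤ c * (b - a) ^ (θ - 1) * (b - a) := by positivity
  simp only [Pi.sub_apply, clipped]
  rcases le_total t a with hta | hat
  · have htb := hta.trans hab
    have e1 : max s (min t a) = t := by rw [min_eq_left hta, max_eq_right hst]
    have e2 : max s (min t b) = t := by rw [min_eq_left htb, max_eq_right hst]
    have e3 : max s (min v a) = max t (min v a) := by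
      rw [max_eq_right (le_min htv hta), max_eq_right (hst.trans (le_min htv hta))]
    have e4 : max s (min v b) = max t (min v b) := by
      rw [max_eq_right (le_min htv htb), max_eq_right (hst.trans (le_min htv htb))]
    rw [e1, e2, e3, e4, hdiag]
    simpa using hpos
  have eA : max s (min t a) = max s (min v a) := by
    rw [min_eq_right hat, min_eq_right (hat.trans htv)]
  have eA' : max t (min v a) = t := max_eq_left ((min_le_right _ _).trans hat)
  rcases le_total b t with hbt | htb
  · have e2 : max s (min t b) = max s (min v b) := by
      rw [min_eq_right hbt, min_eq_right (hbt.trans htv)]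
    have e4 : max t (min v b) = t := max_eq_left ((min_le_right _ _).trans hbt)
    rw [eA, eA', e2, e4, hdiag]
    simpa using hpos
  · have e2 : max s (min t b) = t := by rw [min_eq_left htb, max_eq_right hst]
    have e4 : max t (min v b) = max s (min v b) := by
      rw [max_eq_right (le_min htv htb), max_eq_right (hst.trans (le_min htv htb))]
    rw [eA, eA', e2, e4]
    have hle : max s (min v a) ≤ t := max_le hst ((min_le_right _ _).trans hat)
    have hge : t ≤ max s (min v b) := le_max_of_le_right (le_min htv htb)
    refine (hW _ t _ (hs.trans (le_max_left _ _)) hle hge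
      ((max_le (hst.trans htv) (min_le_left _ _)).trans hv)).trans ?_
    rw [mul_assoc, ← rpow_eq_rpow_sub_one_mul h0 hθ]
    have := clip_sub_clip_le (s := s) (t := v) hab
    have : 0 ≤ max s (min v b) - max s (min v a) := by linarith
    gcongr

/-- **Sewing lemma**: an almost additive two-parameter function on `[0, 1]` is close to the
increments of a one-parameter function. -/
theorem exists_sewing (hc : 0 ≤ c) (hθ : 1 < θ)
    (hW : ∀ s u t, 0 ≤ s → s ≤ u → u ≤ t → t ≤ 1 →
      |W s t - W s u - W u t| ≤ c * (t - s) ^ θ) :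
    ∃ f : ℝ → ℝ, ∀ s t, 0 ≤ s → s ≤ t → t ≤ 1 →
      |f t - f s - W s t| ≤ c / (1 - 2 ^ (1 - θ)) * (t - s) ^ θ := by
  have hγ : 0 < (θ - 1) / 2 := by linarith
  have hq := two_rpow_neg_lt_one hγ
  have hstep : ∀ s t, 0 ≤ s → s ≤ t → t ≤ 1 → ∀ m : ℕ,
      dist (dyadicSum (clipped W s t) m 0 1) (dyadicSum (clipped W s t) (m + 1) 0 1) ≤
        c * (t - s) ^ ((θ - 1) / 2) * (t - s) * ((2 : ℝ) ^ (-((θ - 1) / 2))) ^ m := by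
    intro s t hs hst ht m
    have h := abs_dyadicSum_le (g := fun x => max s (min t x))
      (fun a b _ hab _ => abs_clipped_midpoint_defect_le hc hθ hW hs hst ht a b hab)
      m le_rfl zero_le_one le_rfl
    rw [dyadicSum_sub, dyadicSum_dyadicSum_one, div_two_pow_rpow (by norm_num), sub_zero,
      Real.one_rpow, min_eq_left ht, min_eq_right (hs.trans hst), max_eq_right hst,
      max_eq_left hs] at h
    rw [dist_comm, Real.dist_eq]
    exact h.trans (le_of_eq (by ring))
  have hlim : ∀ s t, 0 ≤ s → s ≤ t → t ≤ 1 → ∃ l,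
      Filter.Tendsto (fun m => dyadicSum (clipped W s t) m 0 1) Filter.atTop (nhds l) :=
    fun s t hs hst ht =>
      cauchySeq_tendsto_of_complete (cauchySeq_of_le_geometric _ _ hq (hstep s t hs hst ht))
  choose! F hF using hlim
  have hadd : ∀ s t v, 0 ≤ s → s ≤ t → t ≤ v → v ≤ 1 → F s v - F s t - F t v = 0 := by
    intro s t v hs hst htv hv
    have h1 := ((hF s v hs (hst.trans htv) hv).sub (hF s t hs hst (htv.trans hv))).sub
      (hF t v (hs.trans hst) htv hv)
    refine tendsto_nhds_unique h1 (squeeze_zero_norm (fun m => ?_)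
      (tendsto_div_two_pow_rpow (x := 1 - 0) (by norm_num) (γ := θ - 1) (by linarith) c (1 - 0)))
    have h := abs_dyadicSum_le (g := id)
      (fun a b _ hab _ => abs_clipped_additivity_defect_le hc hθ hW hs hst htv hv a b hab)
      m le_rfl zero_le_one le_rfl
    rw [dyadicSum_sub, dyadicSum_sub] at h
    exact h
  have hclose : ∀ s t, 0 ≤ s → s ≤ t → t ≤ 1 → |F s t - W s t| ≤
      c / (1 - 2 ^ (-((θ - 1) / 2))) * (t - s) ^ ((θ - 1) / 2 + 1) := by
    intro s t hs hst ht
    have h := dist_le_of_le_geometric_of_tendsto₀ _ _ hq (hstep s t hs hst ht) (hF s t hs hst ht)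
    have e : dyadicSum (clipped W s t) 0 0 1 = W s t := by
      simp only [dyadicSum, clipped]
      rw [min_eq_left ht, min_eq_right (hs.trans hst), max_eq_right hst, max_eq_left hs]
    rw [e, dist_comm, Real.dist_eq] at h
    rw [Real.rpow_add_one' (by linarith) (by linarith)]
    exact h.trans (le_of_eq (by ring))
  refine ⟨fun t => F 0 t, fun s t hs hst ht => ?_⟩
  have hF0 : F 0 t - F 0 s = F s t := by linarith [hadd 0 s t le_rfl hs hst ht]
  rw [hF0]
  refine abs_le_of_almost_midpoint_additive (E := fun s t => F s t - W s t) hθ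
    (by linarith) (fun s t hs hst ht => ?_) hclose hs hst ht
  have h1 := hadd s ((s + t) / 2) t hs (by linarith) (by linarith) ht
  have h2 := hW s ((s + t) / 2) t hs (by linarith) (by linarith) ht
  have e : F s t - W s t - (F s ((s + t) / 2) - W s ((s + t) / 2)) -
      (F ((s + t) / 2) t - W ((s + t) / 2) t) =
      -(W s t - W s ((s + t) / 2) - W ((s + t) / 2) t) := by linear_combination h1
  rw [e, abs_neg]
  exact h2

/-- A function whose increments are controlled by a continuous two-parameter function
vanishing on the diagonal is continuous. -/
theorem continuousOn_of_abs_sub_sub_le {f : ℝ → ℝ} {K : ℝ} (hθ : 0 < θ)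
    (hWc : ContinuousOn (fun q : ℝ × ℝ => W q.1 q.2) {q | 0 ≤ q.1 ∧ q.1 ≤ q.2 ∧ q.2 ≤ 1})
    (hdiag : ∀ s, 0 ≤ s → s ≤ 1 → W s s = 0)
    (hf : ∀ s t, 0 ≤ s → s ≤ t → t ≤ 1 → |f t - f s - W s t| ≤ K * (t - s) ^ θ) :
    ContinuousOn f (Set.Icc 0 1) := by
  intro x hx
  have hcont : ContinuousOn (fun y => |W (min x y) (max x y)| + K * (max x y - min x y) ^ θ)
      (Set.Icc 0 1) := by
    refine ContinuousOn.add (ContinuousOn.abs ?_) (Continuous.continuousOn ?_)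
    · exact hWc.comp (f := fun y => (min x y, max x y)) (by fun_prop)
        fun y hy => ⟨le_min hx.1 hy.1, min_le_max, max_le hx.2 hy.2⟩
    · exact continuous_const.mul (Continuous.rpow_const (by fun_prop) fun _ => Or.inr hθ.le)
  have hlim := hcont x hx
  rw [ContinuousWithinAt, max_self, min_self, hdiag x hx.1 hx.2, sub_self,
    Real.zero_rpow hθ.ne', abs_zero, mul_zero, add_zero] at hlim
  rw [ContinuousWithinAt, tendsto_iff_dist_tendsto_zero]
  refine squeeze_zero' (Filter.Eventually.of_forall fun _ => dist_nonneg) ?_ hlim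
  filter_upwards [self_mem_nhdsWithin] with y hy
  rw [Real.dist_eq]
  rcases le_total x y with h | h
  · rw [min_eq_left h, max_eq_right h]
    have := abs_le.1 (hf x y hx.1 h hy.2)
    have := neg_abs_le (W x y)
    have := le_abs_self (W x y)
    rw [abs_le]; constructor <;> linarith
  · rw [min_eq_right h, max_eq_left h]
    have := abs_le.1 (hf y x hy.1 h hx.2)
    have := neg_abs_le (W y x)
    have := le_abs_self (W y x)
    rw [abs_le]; constructor <;> linarith

end Sewing

theorem abs_le_tnorm {ℓ k : ℕ} (g : List (Fin ℓ) → ℝ) {w : List (Fin ℓ)} (hw : w.length = k) :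
    |g w| ≤ tnorm ℓ k g := by
  subst hw
  apply Real.abs_le_sqrt
  have := Finset.single_le_sum (f := fun v : Fin w.length → Fin ℓ => g (List.ofFn v) ^ 2)
    (fun _ _ => sq_nonneg _) (Finset.mem_univ w.get)
  simpa using this

theorem tnorm_le_of_abs_le {ℓ k : ℕ} {g : List (Fin ℓ) → ℝ} {B : ℝ} (hB : 0 ≤ B)
    (h : ∀ w : List (Fin ℓ), w.length = k → |g w| ≤ B) :
    tnorm ℓ k g ≤ Real.sqrt (Fintype.card (Fin k → Fin ℓ)) * B := by
  rw [tnorm, ← Real.sqrt_sq hB, ← Real.sqrt_mul (by positivity)]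
  apply Real.sqrt_le_sqrt
  have := Finset.sum_le_card_nsmul Finset.univ
    (fun v : Fin k → Fin ℓ => g (List.ofFn v) ^ 2) (B ^ 2)
    fun v _ => sq_le_sq' (abs_le.1 (h _ (by simp))).1 (abs_le.1 (h _ (by simp))).2
  simpa using this

/-- The terms of the product `X_{us} ⊗ X_{tu}` at the word `w` in which both factors have
positive level. -/
noncomputable def crossTerm {ℓ : ℕ} (X : ℝ → ℝ → List (Fin ℓ) → ℝ) (w : List (Fin ℓ))
    (s u t : ℝ) : ℝ :=
  ∑ i ∈ Finset.Ioo 0 w.length, X u s (w.take i) * X t u (w.drop i)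

section Multiplicative

variable {ℓ n : ℕ} {X : ℝ → ℝ → List (Fin ℓ) → ℝ}

theorem crossTerm_cocycle (hX0 : ∀ s t : ℝ, X t s [] = 1)
    (hXmult : ∀ s u t : ℝ, 0 ≤ s → s ≤ u → u ≤ t → t ≤ 1 →
      ∀ w : List (Fin ℓ), 1 ≤ w.length → w.length ≤ n →
      X t s w = ∑ i ∈ Finset.range (w.length + 1), X u s (w.take i) * X t u (w.drop i))
    {w : List (Fin ℓ)} (hw : w.length = n + 1) {s u t v : ℝ}
    (hs : 0 ≤ s) (hsu : s ≤ u) (hut : u ≤ t) (htv : t ≤ v) (hv : v ≤ 1) :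
    crossTerm X w s u v + crossTerm X w u t v = crossTerm X w s t v + crossTerm X w s u t := by
  set B : ℕ → ℕ → ℝ := fun i k => X t u ((w.drop i).take (k - i)) with hB
  have h1 : crossTerm X w s u v = (∑ i ∈ Finset.Ioo 0 (n + 1), ∑ k ∈ Finset.Ico i (n + 1),
      X u s (w.take i) * B i k * X v t (w.drop k)) + crossTerm X w s u t := by
    rw [crossTerm, crossTerm, hw, ← Finset.sum_add_distrib]
    refine Finset.sum_congr rfl fun i hi => ?_
    rw [Finset.mem_Ioo] at hi
    have hl : (w.drop i).length = n + 1 - i := by simp [hw]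
    rw [hXmult u t v (hs.trans hsu) hut htv hv (w.drop i) (by omega) (by omega), hl,
      Finset.sum_range_succ, mul_add, Finset.mul_sum, Finset.sum_Ico_eq_sum_range]
    congr 1
    · refine Finset.sum_congr rfl fun j _ => ?_
      simp only [hB, List.drop_drop, Nat.add_sub_cancel_left]
      ring
    · rw [List.take_of_length_le hl.le, List.drop_of_length_le hl.le, hX0, mul_one]
  have h2 : crossTerm X w s t v = (∑ k ∈ Finset.Ioo 0 (n + 1), ∑ i ∈ Finset.Ioc 0 k,
      X u s (w.take i) * B i k * X v t (w.drop k)) + crossTerm X w u t v := by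
    rw [crossTerm, crossTerm, hw, ← Finset.sum_add_distrib]
    refine Finset.sum_congr rfl fun k hk => ?_
    rw [Finset.mem_Ioo] at hk
    have hl : (w.take k).length = k := by simp [hw]; omega
    rw [hXmult s u t hs hsu hut (htv.trans hv) (w.take k) (by omega) (by omega), hl,
      Finset.range_eq_Ico, Finset.sum_eq_sum_Ico_succ_bot (by omega), add_comm, add_mul,
      Finset.sum_mul]
    congr 1
    · refine Finset.sum_congr (by ext; simp; omega) fun i hi => ?_
      rw [Finset.mem_Ioc] at hi
      simp only [hB, List.drop_take, List.take_take, min_eq_left hi.2]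
    · simp [hX0]
  have hswap : (∑ i ∈ Finset.Ioo 0 (n + 1), ∑ k ∈ Finset.Ico i (n + 1),
      X u s (w.take i) * B i k * X v t (w.drop k)) = ∑ k ∈ Finset.Ioo 0 (n + 1),
      ∑ i ∈ Finset.Ioc 0 k, X u s (w.take i) * B i k * X v t (w.drop k) :=
    Finset.sum_comm' fun i k => by simp only [Finset.mem_Ioo, Finset.mem_Ico, Finset.mem_Ioc]; omega
  rw [h1, h2, hswap]
  ring

theorem continuousOn_crossTerm_zero
    (hXcont : ∀ w : List (Fin ℓ), w.length ≤ n →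
      ContinuousOn (fun q : ℝ × ℝ => X q.2 q.1 w)
        {q : ℝ × ℝ | 0 ≤ q.1 ∧ q.1 ≤ q.2 ∧ q.2 ≤ 1})
    {w : List (Fin ℓ)} (hw : w.length = n + 1) :
    ContinuousOn (fun q : ℝ × ℝ => crossTerm X w 0 q.1 q.2)
      {q : ℝ × ℝ | 0 ≤ q.1 ∧ q.1 ≤ q.2 ∧ q.2 ≤ 1} := by
  refine continuousOn_finsetSum _ fun i hi => ?_
  rw [Finset.mem_Ioo] at hi
  refine ContinuousOn.mul ?_ (hXcont _ (by simp; omega))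
  exact (hXcont (w.take i) (by simp; omega)).comp (f := fun q : ℝ × ℝ => ((0 : ℝ), q.1))
    (by fun_prop) fun q hq => ⟨le_rfl, hq.1, hq.2.1.trans hq.2.2⟩

theorem sum_range_ite_eq_add_crossTerm (hX0 : ∀ s t : ℝ, X t s [] = 1)
    (Y : ℝ → ℝ → List (Fin ℓ) → ℝ) {w : List (Fin ℓ)} (hw : w.length = n + 1) (s u t : ℝ) :
    ∑ i ∈ Finset.range (w.length + 1),
      (if (w.take i).length ≤ n then X u s (w.take i) else Y u s (w.take i)) *
      (if (w.drop i).length ≤ n then X t u (w.drop i) else Y t u (w.drop i)) =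
    Y u s w + Y t u w + crossTerm X w s u t := by
  rw [Finset.sum_range_succ, Finset.range_eq_Ico, Finset.sum_eq_sum_Ico_succ_bot (by omega),
    crossTerm]
  have hmid : ∑ i ∈ Finset.Ico (0 + 1) w.length,
      (if (w.take i).length ≤ n then X u s (w.take i) else Y u s (w.take i)) *
      (if (w.drop i).length ≤ n then X t u (w.drop i) else Y t u (w.drop i)) =
      ∑ i ∈ Finset.Ioo 0 w.length, X u s (w.take i) * X t u (w.drop i) := by
    refine Finset.sum_congr (by ext; simp; omega) fun i hi => ?_
    rw [Finset.mem_Ioo] at hi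
    rw [if_pos (by simp; omega), if_pos (by simp; omega)]
  rw [hmid]
  rw [List.take_of_length_le le_rfl, List.drop_of_length_le le_rfl]
  simp [hw, hX0]
  ring

end Multiplicative

/-- **Lyons' extension theorem, one step.**  If `X = (1, X¹, …, Xⁿ)` is a continuous
multiplicative map with values in `T^{(n),1}_ℓ` and `Y^{n+1}` is a continuous candidate
level-`(n+1)` component such that `(1, X¹, …, Xⁿ, Y^{n+1})` is almost multiplicative,
`|Y^{n+1}_{ts} - (Y_{us} Y_{tu})^{n+1}| ≤ c |t-s|^{(n+1)a}` with `a > 1`, then there is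
a unique continuous `X^{n+1}` making `(1, X¹, …, Xⁿ, X^{n+1})` multiplicative with
`|X^{n+1}_{ts} - Y^{n+1}_{ts}| ≤ c₁ |t-s|^{(n+1)a}` for some `c₁ > 0`. -/
theorem lyons_extension_step
    (ℓ n : ℕ) (hℓ : 1 ≤ ℓ) (hn : 1 ≤ n)
    (c a : ℝ) (hc : 0 < c) (ha : 1 < a)
    (X : ℝ → ℝ → List (Fin ℓ) → ℝ)
    (hX0 : ∀ s t : ℝ, X t s [] = 1)
    (hXcont : ∀ w : List (Fin ℓ), w.length ≤ n →
      ContinuousOn (fun q : ℝ × ℝ => X q.2 q.1 w)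
        {q : ℝ × ℝ | 0 ≤ q.1 ∧ q.1 ≤ q.2 ∧ q.2 ≤ 1})
    (hXmult : ∀ s u t : ℝ, 0 ≤ s → s ≤ u → u ≤ t → t ≤ 1 →
      ∀ w : List (Fin ℓ), 1 ≤ w.length → w.length ≤ n →
      X t s w = ∑ i ∈ Finset.range (w.length + 1), X u s (w.take i) * X t u (w.drop i))
    (Y : ℝ → ℝ → List (Fin ℓ) → ℝ)
    (hYcont : ∀ w : List (Fin ℓ), w.length = n + 1 →
      ContinuousOn (fun q : ℝ × ℝ => Y q.2 q.1 w)
        {q : ℝ × ℝ | 0 ≤ q.1 ∧ q.1 ≤ q.2 ∧ q.2 ≤ 1})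
    (hYalmost : ∀ s u t : ℝ, 0 ≤ s → s ≤ u → u ≤ t → t ≤ 1 →
      tnorm ℓ (n + 1) (fun w =>
        Y t s w - ∑ i ∈ Finset.range (w.length + 1),
          (if (w.take i).length ≤ n then X u s (w.take i) else Y u s (w.take i)) *
          (if (w.drop i).length ≤ n then X t u (w.drop i) else Y t u (w.drop i))) ≤
        c * (t - s) ^ ((n + 1 : ℝ) * a)) :
    ∃ Z : ℝ → ℝ → List (Fin ℓ) → ℝ, IsExtension ℓ n a X Y Z ∧
      ∀ Z' : ℝ → ℝ → List (Fin ℓ) → ℝ, IsExtension ℓ n a X Y Z' →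
        ∀ s t : ℝ, 0 ≤ s → s ≤ t → t ≤ 1 → ∀ w : List (Fin ℓ), w.length = n + 1 →
          Z' t s w = Z t s w := by
  have hθ : 1 < (n + 1 : ℝ) * a := by
    have : (0 : ℝ) ≤ n := Nat.cast_nonneg n
    nlinarith
  set θ : ℝ := (n + 1 : ℝ) * a with hθdef
  set W : List (Fin ℓ) → ℝ → ℝ → ℝ := fun w s t => Y t s w + crossTerm X w 0 s t with hWdef
  have hcocycle : ∀ w : List (Fin ℓ), w.length = n + 1 → ∀ s u t, 0 ≤ s → s ≤ u → u ≤ t → t ≤ 1 →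
      crossTerm X w 0 s t + crossTerm X w s u t = crossTerm X w 0 u t + crossTerm X w 0 s u :=
    fun w hw s u t hs hsu hut ht => crossTerm_cocycle hX0 hXmult hw le_rfl hs hsu hut ht
  have hW : ∀ w : List (Fin ℓ), w.length = n + 1 → ∀ s u t, 0 ≤ s → s ≤ u → u ≤ t → t ≤ 1 →
      |W w s t - W w s u - W w u t| ≤ c * (t - s) ^ θ := by
    intro w hw s u t hs hsu hut ht
    have h := (abs_le_tnorm _ hw).trans (hYalmost s u t hs hsu hut ht)
    rw [sum_range_ite_eq_add_crossTerm hX0 Y hw] at h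
    have e : W w s t - W w s u - W w u t = Y t s w - (Y u s w + Y t u w + crossTerm X w s u t) := by
      simp only [hWdef]
      linear_combination hcocycle w hw s u t hs hsu hut ht
    rwa [e]
  have hWdiag : ∀ w : List (Fin ℓ), w.length = n + 1 → ∀ s, 0 ≤ s → s ≤ 1 → W w s s = 0 := by
    intro w hw s hs hs1
    have := hW w hw s s s hs le_rfl le_rfl hs1
    rw [sub_self s, Real.zero_rpow (by linarith), mul_zero] at this
    linarith [abs_nonpos_iff.1 this]
  have hsew := fun (w : List (Fin ℓ)) (hw : w.length = n + 1) => exists_sewing hc.le hθ (hW w hw)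
  choose! f hf using hsew
  set K : ℝ := c / (1 - 2 ^ (1 - θ)) with hK
  have hKpos : 0 < K := by
    have := two_rpow_neg_lt_one (γ := θ - 1) (by linarith)
    rw [neg_sub] at this
    exact div_pos hc (by linarith)
  refine ⟨fun t s w => f w t - f w s - crossTerm X w 0 s t, ⟨?_, ?_, ?_⟩, ?_⟩
  · intro w hw
    have hcr := continuousOn_crossTerm_zero hXcont hw
    have hfc := continuousOn_of_abs_sub_sub_le (by linarith) ((hYcont w hw).add hcr)
      (hWdiag w hw) (hf w hw)
    refine ContinuousOn.sub (ContinuousOn.sub ?_ ?_) hcr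
    · exact hfc.comp continuous_snd.continuousOn fun q hq => ⟨hq.1.trans hq.2.1, hq.2.2⟩
    · exact hfc.comp continuous_fst.continuousOn fun q hq => ⟨hq.1, hq.2.1.trans hq.2.2⟩
  · intro s u t hs hsu hut ht w hw
    have := hcocycle w hw s u t hs hsu hut ht
    change _ = _ + _ + crossTerm X w s u t
    linear_combination -this
  · refine ⟨Real.sqrt (Fintype.card (Fin (n + 1) → Fin ℓ)) * K + 1, by positivity,
      fun s t hs hst ht => ?_⟩
    have hp : 0 ≤ (t - s) ^ θ := Real.rpow_nonneg (by linarith) _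
    refine (tnorm_le_of_abs_le (B := K * (t - s) ^ θ) (by positivity) fun w hw => ?_).trans ?_
    · rw [sub_sub, add_comm]
      exact hf w hw s t hs hst ht
    · linarith
  · rintro Z' ⟨-, hmul, c₁, -, hclose⟩ s t hs hst ht w hw
    have h := abs_le_of_almost_midpoint_additive (c := 0) (C := c₁ + K) hθ hθ
      (E := fun s t => Z' t s w - (f w t - f w s - crossTerm X w 0 s t))
      (fun s t hs hst ht => ?_) (fun s t hs hst ht => ?_) hs hst ht
    · rw [zero_div, zero_mul] at h
      linarith [abs_nonpos_iff.1 h]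
    · have h1 := hcocycle w hw s ((s + t) / 2) t hs (by linarith) (by linarith) ht
      have h2 : Z' t s w = _ + _ + crossTerm X w s ((s + t) / 2) t :=
        hmul s ((s + t) / 2) t hs (by linarith) (by linarith) ht w hw
      rw [zero_mul, abs_nonpos_iff]
      linear_combination h1 + h2
    · have h1 := (abs_le_tnorm _ hw).trans (hclose s t hs hst ht)
      have h2 := hf w hw s t hs hst ht
      have e : Z' t s w - (f w t - f w s - crossTerm X w 0 s t) =
          (Z' t s w - Y t s w) - (f w t - f w s - W w s t) := by
        simp only [hWdef]; ring
      rw [e, add_mul]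
      exact (abs_sub _ _).trans (add_le_add h1 h2)
end
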